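/- Let M be an intra-regular po-Γ-semigroup. Then for every x ∈ M, the set (x)_𝒩 is a maximal simple subsemigroup of M; that is, (x)_𝒩 is a simple subsemigroup of M and every simple subsemigroup T of M with (x)_𝒩 ⊆ T satisfies T = (x)_𝒩. -/

import Mathlib

namespace PGS

variable {M : Type*} {Γ : Type*}

/-- `AΓB = {aγb : a ∈ A, b ∈ B, γ ∈ Γ}`. -/
def gprod (op : Γ → M → M → M) (A B : Set M) : Set M :=
  {x | ∃ a ∈ A, ∃ b ∈ B, ∃ γ : Γ, x = op γ a b}

/-- `(H] = {t : t ≤ h for some h ∈ H}`. -/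
def dcl [PartialOrder M] (H : Set M) : Set M :=
  {t | ∃ h ∈ H, t ≤ h}

/-- `M` with the family of operations `op : Γ → M → M → M` and the partial order `≤`
is a po-Γ-semigroup: `(aγb)μc = aγ(bμc)` and the order is compatible with the operations. -/
def IsPoGammaSemigroup [PartialOrder M] (op : Γ → M → M → M) : Prop :=
  (∀ (a b c : M) (γ μ : Γ), op μ (op γ a b) c = op γ a (op μ b c)) ∧
  (∀ (a b c : M) (γ : Γ), a ≤ b → op γ a c ≤ op γ b c) ∧
  (∀ (a b c : M) (γ : Γ), a ≤ b → op γ c a ≤ op γ c b)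

/-- Left ideal of `M`: `MΓA ⊆ A` and `A` is downward closed. -/
def IsLeftIdeal [PartialOrder M] (op : Γ → M → M → M) (A : Set M) : Prop :=
  gprod op Set.univ A ⊆ A ∧ ∀ a ∈ A, ∀ b : M, b ≤ a → b ∈ A

/-- Right ideal of `M`: `AΓM ⊆ A` and `A` is downward closed. -/
def IsRightIdeal [PartialOrder M] (op : Γ → M → M → M) (A : Set M) : Prop :=
  gprod op A Set.univ ⊆ A ∧ ∀ a ∈ A, ∀ b : M, b ≤ a → b ∈ A

/-- Ideal of `M`: both a left and a right ideal. -/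
def IsIdeal [PartialOrder M] (op : Γ → M → M → M) (A : Set M) : Prop :=
  IsLeftIdeal op A ∧ IsRightIdeal op A

/-- A prime subset: `aγb ∈ T` implies `a ∈ T` or `b ∈ T`. -/
def IsPrimeSubset (op : Γ → M → M → M) (T : Set M) : Prop :=
  ∀ (a b : M) (γ : Γ), op γ a b ∈ T → a ∈ T ∨ b ∈ T

/-- A semiprime subset: `aγa ∈ T` implies `a ∈ T`. -/
def IsSemiprimeSubset (op : Γ → M → M → M) (T : Set M) : Prop :=
  ∀ (a : M) (γ : Γ), op γ a a ∈ T → a ∈ T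

/-- A weakly prime subset: for all ideals `A`, `B` of `M` with `AΓB ⊆ T`,
`A ⊆ T` or `B ⊆ T`. -/
def IsWeaklyPrimeSubset [PartialOrder M] (op : Γ → M → M → M) (T : Set M) : Prop :=
  ∀ A B : Set M, IsIdeal op A → IsIdeal op B → gprod op A B ⊆ T → A ⊆ T ∨ B ⊆ T

/-- Intra-regular: `x ∈ (MΓ{xγx}ΓM]` for all `x`, `γ`. -/
def IsIntraRegular [PartialOrder M] (op : Γ → M → M → M) : Prop :=
  ∀ (x : M) (γ : Γ),
    x ∈ dcl (gprod op (gprod op Set.univ {op γ x x}) Set.univ)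

/-- Left regular: `x ∈ (MΓ{xγx}]` for all `x`, `γ`. -/
def IsLeftRegular [PartialOrder M] (op : Γ → M → M → M) : Prop :=
  ∀ (x : M) (γ : Γ), x ∈ dcl (gprod op Set.univ {op γ x x})

/-- Left duo: every left ideal of `M` is an ideal of `M`. -/
def IsLeftDuo [PartialOrder M] (op : Γ → M → M → M) : Prop :=
  ∀ A : Set M, IsLeftIdeal op A → IsIdeal op A

/-- A subsemigroup: a nonempty subset `T` with `TΓT ⊆ T`. -/
def IsSubsemigroup (op : Γ → M → M → M) (T : Set M) : Prop :=
  T.Nonempty ∧ gprod op T T ⊆ T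

/-- An ideal of a subsemigroup `T`: a nonempty subset `I` of `T` with `TΓI ⊆ I`,
`IΓT ⊆ I`, closed downward inside `T`. -/
def IsIdealOfSub [PartialOrder M] (op : Γ → M → M → M) (T I : Set M) : Prop :=
  I.Nonempty ∧ I ⊆ T ∧ gprod op T I ⊆ I ∧ gprod op I T ⊆ I ∧
    ∀ a ∈ I, ∀ b ∈ T, b ≤ a → b ∈ I

/-- A left ideal of a subsemigroup `T`: a nonempty subset `I` of `T` with `TΓI ⊆ I`,
closed downward inside `T`. -/
def IsLeftIdealOfSub [PartialOrder M] (op : Γ → M → M → M) (T I : Set M) : Prop :=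
  I.Nonempty ∧ I ⊆ T ∧ gprod op T I ⊆ I ∧ ∀ a ∈ I, ∀ b ∈ T, b ≤ a → b ∈ I

/-- A simple subsemigroup: a subsemigroup having no ideal other than itself. -/
def IsSimpleSub [PartialOrder M] (op : Γ → M → M → M) (T : Set M) : Prop :=
  IsSubsemigroup op T ∧ ∀ I : Set M, IsIdealOfSub op T I → I = T

/-- A left simple subsemigroup: a subsemigroup having no left ideal other than itself. -/
def IsLeftSimpleSub [PartialOrder M] (op : Γ → M → M → M) (T : Set M) : Prop :=
  IsSubsemigroup op T ∧ ∀ I : Set M, IsLeftIdealOfSub op T I → I = T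

/-- A filter of `M`: a subsemigroup `F` such that `aγb ∈ F` implies `a ∈ F` and `b ∈ F`,
and `F` is upward closed. -/
def IsFilterSub [PartialOrder M] (op : Γ → M → M → M) (F : Set M) : Prop :=
  IsSubsemigroup op F ∧ (∀ (a b : M) (γ : Γ), op γ a b ∈ F → a ∈ F ∧ b ∈ F) ∧
    ∀ a ∈ F, ∀ c : M, a ≤ c → c ∈ F

/-- `N(x)`: the least filter of `M` containing `x`. -/
def Nfil [PartialOrder M] (op : Γ → M → M → M) (x : M) : Set M :=
  ⋂₀ {F : Set M | IsFilterSub op F ∧ x ∈ F}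

/-- The `𝒩`-class `(x)_𝒩` of `x`, where `a 𝒩 b` iff `N(a) = N(b)`. -/
def Ncls [PartialOrder M] (op : Γ → M → M → M) (x : M) : Set M :=
  {y | Nfil op y = Nfil op x}

/-- `L(a) = ({a} ∪ MΓ{a}]`, the left ideal of `M` generated by `a`. -/
def Lgen [PartialOrder M] (op : Γ → M → M → M) (a : M) : Set M :=
  dcl ({a} ∪ gprod op Set.univ {a})

/-- `I(a) = ({a} ∪ MΓ{a} ∪ {a}ΓM ∪ MΓ{a}ΓM]`, the ideal of `M` generated by `a`. -/
def Igen [PartialOrder M] (op : Γ → M → M → M) (a : M) : Set M :=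
  dcl ({a} ∪ gprod op Set.univ {a} ∪ gprod op {a} Set.univ ∪
    gprod op (gprod op Set.univ {a}) Set.univ)

/-- A semilattice congruence on `M`. -/
def IsSemilatticeCong (op : Γ → M → M → M) (σ : M → M → Prop) : Prop :=
  Equivalence σ ∧
  (∀ (a b c : M) (γ : Γ), σ a b → σ (op γ a c) (op γ b c)) ∧
  (∀ (a b c : M) (γ : Γ), σ a b → σ (op γ c a) (op γ c b)) ∧
  (∀ (a b : M) (γ : Γ), σ (op γ a b) (op γ b a)) ∧
  (∀ (a : M) (γ : Γ), σ (op γ a a) a)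

/-- The `σ`-class of `x`. -/
def cls (σ : M → M → Prop) (x : M) : Set M := {y | σ y x}

/-- `M` is a semilattice of simple semigroups. -/
def IsSemilatticeOfSimple [PartialOrder M] (op : Γ → M → M → M) : Prop :=
  ∃ σ : M → M → Prop, IsSemilatticeCong op σ ∧ ∀ x : M, IsSimpleSub op (cls σ x)

/-- `M` is a semilattice of left simple semigroups. -/
def IsSemilatticeOfLeftSimple [PartialOrder M] (op : Γ → M → M → M) : Prop :=
  ∃ σ : M → M → Prop, IsSemilatticeCong op σ ∧ ∀ x : M, IsLeftSimpleSub op (cls σ x)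

/-- `M` is a chain of simple semigroups. -/
def IsChainOfSimple [PartialOrder M] (op : Γ → M → M → M) : Prop :=
  ∃ σ : M → M → Prop, IsSemilatticeCong op σ ∧ (∀ x : M, IsSimpleSub op (cls σ x)) ∧
    ∀ (x y : M) (γ : Γ), cls σ x = cls σ (op γ x y) ∨ cls σ y = cls σ (op γ x y)

/-- `(MΓ{a}ΓM]`, which in an intra-regular po-Γ-semigroup is the ideal generated by `a`. -/
def twoSided [PartialOrder M] (op : Γ → M → M → M) (a : M) : Set M :=
  dcl (gprod op (gprod op Set.univ {a}) Set.univ)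

section

variable [PartialOrder M] {op : Γ → M → M → M}

theorem mem_twoSided {a t : M} :
    t ∈ twoSided op a ↔ ∃ u v γ μ, t ≤ op μ (op γ u a) v := by
  constructor
  · rintro ⟨_, ⟨_, ⟨u, -, _, rfl, γ, rfl⟩, v, -, μ, rfl⟩, h⟩
    exact ⟨u, v, γ, μ, h⟩
  · rintro ⟨u, v, γ, μ, h⟩
    exact ⟨_, ⟨_, ⟨u, trivial, _, rfl, γ, rfl⟩, v, trivial, μ, rfl⟩, h⟩

theorem isIdeal_twoSided (hM : IsPoGammaSemigroup op) (a : M) :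
    IsIdeal op (twoSided op a) := by
  obtain ⟨assoc, mul_right, mul_left⟩ := hM
  have down : ∀ s ∈ twoSided op a, ∀ t, t ≤ s → t ∈ twoSided op a := by
    rintro s ⟨h, hh, hs⟩ t ht
    exact ⟨h, hh, ht.trans hs⟩
  refine ⟨⟨?_, down⟩, ?_, down⟩
  · rintro _ ⟨c, -, t, ht, δ, rfl⟩
    obtain ⟨u, v, γ, μ, h⟩ := mem_twoSided.1 ht
    refine mem_twoSided.2 ⟨op δ c u, v, γ, μ, (mul_left _ _ c δ h).trans_eq ?_⟩
    simp only [assoc]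
  · rintro _ ⟨t, ht, c, -, δ, rfl⟩
    obtain ⟨u, v, γ, μ, h⟩ := mem_twoSided.1 ht
    refine mem_twoSided.2 ⟨u, op δ v c, γ, μ, (mul_right _ _ c δ h).trans_eq ?_⟩
    simp only [assoc]

theorem IsIdeal.op_mem_left {A : Set M} (hA : IsIdeal op A) {a : M} (ha : a ∈ A) (c : M)
    (γ : Γ) : op γ c a ∈ A :=
  hA.1.1 ⟨c, trivial, a, ha, γ, rfl⟩

theorem IsIdeal.op_mem_right {A : Set M} (hA : IsIdeal op A) {a : M} (ha : a ∈ A) (c : M)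
    (γ : Γ) : op γ a c ∈ A :=
  hA.2.1 ⟨a, ha, c, trivial, γ, rfl⟩

theorem IsIdeal.twoSided_subset {A : Set M} (hA : IsIdeal op A) {a : M} (ha : a ∈ A) :
    twoSided op a ⊆ A := by
  intro t ht
  obtain ⟨u, v, γ, μ, h⟩ := mem_twoSided.1 ht
  exact hA.1.2 _ (hA.op_mem_right (hA.op_mem_left ha u γ) v μ) _ h

theorem IsIdeal.isSemiprimeSubset (hir : IsIntraRegular op) {A : Set M} (hA : IsIdeal op A) :
    IsSemiprimeSubset op A :=
  fun a γ h => hA.twoSided_subset h (hir a γ)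

theorem mem_twoSided_self [Nonempty Γ] (hM : IsPoGammaSemigroup op) (hir : IsIntraRegular op)
    (a : M) : a ∈ twoSided op a := by
  obtain ⟨γ⟩ := ‹Nonempty Γ›
  obtain ⟨u, v, δ, μ, h⟩ := mem_twoSided.1 (hir a γ)
  refine mem_twoSided.2 ⟨u, op μ a v, δ, γ, h.trans_eq ?_⟩
  simp only [hM.1]

theorem isFilterSub_setOf_mem_twoSided [Nonempty Γ] (hM : IsPoGammaSemigroup op)
    (hir : IsIntraRegular op) (x : M) : IsFilterSub op {y | x ∈ twoSided op y} := by
  have self := mem_twoSided_self hM hir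
  have ideal := isIdeal_twoSided hM
  refine ⟨⟨⟨x, self x⟩, ?_⟩, fun a b γ h => ?_, fun a ha c hac => ?_⟩
  · rintro _ ⟨a, ha, b, hb, γ, rfl⟩
    obtain ⟨u, v, α, β, hxa⟩ := mem_twoSided.1 ha
    obtain ⟨c, d, ε, ζ, hxb⟩ := mem_twoSided.1 hb
    set A := twoSided op (op γ a b)
    have hA : IsIdeal op A := ideal _
    have hba : op α (op γ (op ζ b d) u) a ∈ A := by
      refine hA.isSemiprimeSubset hir _ γ ?_
      have h := hA.op_mem_right (hA.op_mem_left (self (op γ a b)) (op γ (op ζ b d) u) α)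
        (op γ d (op α u a)) ζ
      simpa only [hM.1] using h
    have hprod : op γ (op ζ (op ε c b) d) (op β (op α u a) v) ∈ A := by
      have h := hA.op_mem_right (hA.op_mem_left hba c ε) v β
      simpa only [hM.1] using h
    refine hA.isSemiprimeSubset hir x γ (hA.1.2 _ hprod _ ?_)
    exact (hM.2.1 _ _ _ _ hxb).trans (hM.2.2 _ _ _ _ hxa)
  · exact ⟨(ideal a).twoSided_subset ((ideal a).op_mem_right (self a) b γ) h,
      (ideal b).twoSided_subset ((ideal b).op_mem_left (self b) a γ) h⟩
  · exact (ideal c).twoSided_subset ((ideal c).1.2 _ (self c) _ hac) ha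

theorem self_mem_Nfil (x : M) : x ∈ Nfil op x :=
  Set.mem_sInter.2 fun _ hF => hF.2

theorem Nfil_subset {F : Set M} (hF : IsFilterSub op F) {x : M} (hx : x ∈ F) :
    Nfil op x ⊆ F :=
  Set.sInter_subset_of_mem ⟨hF, hx⟩

theorem isFilterSub_Nfil (x : M) : IsFilterSub op (Nfil op x) := by
  refine ⟨⟨⟨x, self_mem_Nfil x⟩, ?_⟩, fun a b γ h => ⟨fun F hF => ?_, fun F hF => ?_⟩,
    fun a ha c hac F hF => ?_⟩
  · rintro _ ⟨a, ha, b, hb, γ, rfl⟩ F hF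
    exact hF.1.1.2 ⟨a, ha F hF, b, hb F hF, γ, rfl⟩
  · exact (hF.1.2.1 a b γ (h F hF)).1
  · exact (hF.1.2.1 a b γ (h F hF)).2
  · exact hF.1.2.2 a (ha F hF) c hac

theorem mem_Ncls {x y : M} : y ∈ Ncls op x ↔ y ∈ Nfil op x ∧ x ∈ Nfil op y := by
  constructor
  · intro h
    have h : Nfil op y = Nfil op x := h
    exact ⟨h ▸ self_mem_Nfil y, h ▸ self_mem_Nfil x⟩
  · rintro ⟨hyx, hxy⟩
    exact (Nfil_subset (isFilterSub_Nfil x) hyx).antisymm (Nfil_subset (isFilterSub_Nfil y) hxy)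

theorem op_mem_Ncls {x a b : M} (ha : a ∈ Ncls op x) (hb : b ∈ Ncls op x) (γ : Γ) :
    op γ a b ∈ Ncls op x := by
  refine mem_Ncls.2 ⟨(isFilterSub_Nfil x).1.2
    ⟨a, (mem_Ncls.1 ha).1, b, (mem_Ncls.1 hb).1, γ, rfl⟩, ?_⟩
  have h := ((isFilterSub_Nfil _).2.1 a b γ (self_mem_Nfil (op γ a b))).1
  exact Nfil_subset (isFilterSub_Nfil _) h (mem_Ncls.1 ha).2

theorem isSimpleSub_Ncls [Nonempty Γ] (hM : IsPoGammaSemigroup op) (hir : IsIntraRegular op)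
    (x : M) : IsSimpleSub op (Ncls op x) := by
  refine ⟨⟨⟨x, rfl⟩, ?_⟩, ?_⟩
  · rintro _ ⟨a, ha, b, hb, γ, rfl⟩
    exact op_mem_Ncls ha hb γ
  rintro I ⟨⟨a, haI⟩, hIT, hleft, hright, hdown⟩
  refine hIT.antisymm fun b hb => ?_
  obtain ⟨γ⟩ := ‹Nonempty Γ›
  have ha := hIT haI
  have hcube : op γ (op γ a a) a ∈ Nfil op b := by
    have h := (mem_Ncls.1 (op_mem_Ncls (op_mem_Ncls ha ha γ) ha γ)).1
    rwa [show Nfil op b = Nfil op x from hb]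
  obtain ⟨u, v, α, β, hle⟩ := mem_twoSided.1 (Nfil_subset
    (isFilterSub_setOf_mem_twoSided hM hir b) (mem_twoSided_self hM hir b) hcube)
  have hassoc : op β (op α u (op γ (op γ a a) a)) v
      = op γ (op γ (op α u a) a) (op β a v) := by
    simp only [hM.1]
  rw [hassoc] at hle
  have hN := isFilterSub_Nfil (op := op) x
  have hmem := hN.2.2 _ (mem_Ncls.1 hb).1 _ hle
  obtain ⟨hl, hr⟩ := hN.2.1 _ _ _ hmem
  have hx := (mem_Ncls.1 ha).2
  have hua : op α u a ∈ Ncls op x := mem_Ncls.2 ⟨(hN.2.1 _ _ _ hl).1,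
    Nfil_subset (isFilterSub_Nfil _)
      ((isFilterSub_Nfil _).2.1 u a α (self_mem_Nfil _)).2 hx⟩
  have hav : op β a v ∈ Ncls op x := mem_Ncls.2 ⟨hr,
    Nfil_subset (isFilterSub_Nfil _)
      ((isFilterSub_Nfil _).2.1 a v β (self_mem_Nfil _)).1 hx⟩
  exact hdown _ (hright ⟨_, hleft ⟨_, hua, _, haI, γ, rfl⟩, _, hav, γ, rfl⟩) b hb hle

/-- The part of a simple subsemigroup outside a filter is an ideal of it, hence empty as soon
as the filter meets the subsemigroup. -/
theorem IsSimpleSub.subset_of_isFilterSub {T F : Set M} (hT : IsSimpleSub op T)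
    (hF : IsFilterSub op F) {y : M} (hyT : y ∈ T) (hyF : y ∈ F) : T ⊆ F := by
  by_contra hTF
  obtain ⟨t, htT, htF⟩ := Set.not_subset.1 hTF
  have h : T \ F = T := by
    refine hT.2 _ ⟨⟨t, htT, htF⟩, Set.sdiff_subset, ?_, ?_, ?_⟩
    · rintro _ ⟨a, ha, b, hb, γ, rfl⟩
      exact ⟨hT.1.2 ⟨a, ha, b, hb.1, γ, rfl⟩, fun h => hb.2 (hF.2.1 _ _ _ h).2⟩
    · rintro _ ⟨a, ha, b, hb, γ, rfl⟩
      exact ⟨hT.1.2 ⟨a, ha.1, b, hb, γ, rfl⟩, fun h => ha.2 (hF.2.1 _ _ _ h).1⟩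
    · exact fun a ha b hb hba => ⟨hb, fun h => ha.2 (hF.2.2 b h a hba)⟩
  exact (h.symm ▸ hyT : y ∈ T \ F).2 hyF

end

theorem statement_16 [PartialOrder M] [Nonempty M] [Nonempty Γ]
    (op : Γ → M → M → M) (hM : IsPoGammaSemigroup op)
    (hir : IsIntraRegular op) :
    ∀ x : M, IsSimpleSub op (Ncls op x) ∧
      ∀ T : Set M, IsSimpleSub op T → Ncls op x ⊆ T → T = Ncls op x := by
  refine fun x => ⟨isSimpleSub_Ncls hM hir x, fun T hT hsub => ?_⟩
  have hxT : x ∈ T := hsub rfl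
  refine Set.Subset.antisymm (fun y hy => mem_Ncls.2 ⟨?_, ?_⟩) hsub
  · exact hT.subset_of_isFilterSub (isFilterSub_Nfil x) hxT (self_mem_Nfil x) hy
  · exact hT.subset_of_isFilterSub (isFilterSub_Nfil y) hy (self_mem_Nfil y) hxT

end PGS
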